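/- Let (Θ, μ) be a probability space, let λ, ε > 0, p ∈ [0,1], π0 ∈ ℝ, π2 ∈ ℝ, and let u : ℝ × Θ → ℝ. Define the deadband penalty φ(x) = (|x| − ε)²/(2λ) if |x| ≥ ε and φ(x) = 0 otherwise. Let q^a, q^c : Θ → ℝ be μ-integrable with θ ↦ u(q^a(θ),θ) and θ ↦ u(q^c(θ),θ) μ-integrable, and suppose: (a) for every θ, q^a(θ) minimizes q ↦ π0·q − u(q,θ) over ℝ; (b) for every θ, q^c(θ) minimizes q ↦ (π0 + π2)·q − u(q,θ) over ℝ; and (c) |q^a(θ) − ∫ q^a dμ| ≤ ε for every θ. Set f := ∫ q^a(θ) dμ(θ). Then (1−p)·∫ [π0·q^a(θ) − u(q^a(θ),θ) + φ(f − q^a(θ))] dμ(θ) + p·∫ [π0·q^c(θ) − u(q^c(θ),θ) − π2·(f − q^c(θ))] dμ(θ) ≤ ∫ [π0·q^a(θ) − u(q^a(θ),θ)] dμ(θ). -/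

import Mathlib

open MeasureTheory

theorem stmt_14 {Θ : Type*} [MeasurableSpace Θ] (μ : Measure Θ) [IsProbabilityMeasure μ]
    (lam ε : ℝ) (hlam : 0 < lam) (hε : 0 < ε)
    (p : ℝ) (hp : p ∈ Set.Icc (0 : ℝ) 1)
    (π0 π2 : ℝ)
    (u : ℝ → Θ → ℝ)
    (φ : ℝ → ℝ)
    (hφ : ∀ x : ℝ, φ x = if ε ≤ |x| then (|x| - ε) ^ 2 / (2 * lam) else 0)
    (qa qc : Θ → ℝ) (hqa : Integrable qa μ) (hqc : Integrable qc μ)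
    (hua : Integrable (fun θ => u (qa θ) θ) μ)
    (huc : Integrable (fun θ => u (qc θ) θ) μ)
    (hmina : ∀ θ : Θ, ∀ q : ℝ, π0 * qa θ - u (qa θ) θ ≤ π0 * q - u q θ)
    (hminc : ∀ θ : Θ, ∀ q : ℝ, (π0 + π2) * qc θ - u (qc θ) θ ≤ (π0 + π2) * q - u q θ)
    (hspread : ∀ θ : Θ, |qa θ - ∫ θ', qa θ' ∂μ| ≤ ε)
    (f : ℝ) (hf : f = ∫ θ, qa θ ∂μ) :
    (1 - p) * (∫ θ, (π0 * qa θ - u (qa θ) θ + φ (f - qa θ)) ∂μ) +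
      p * (∫ θ, (π0 * qc θ - u (qc θ) θ - π2 * (f - qc θ)) ∂μ) ≤
    ∫ θ, (π0 * qa θ - u (qa θ) θ) ∂μ := by
  obtain ⟨hp0, hp1⟩ := hp
  have hpen : ∀ θ, φ (f - qa θ) = 0 := by
    intro θ
    have h : |f - qa θ| ≤ ε := by
      rw [hf, abs_sub_comm]
      exact hspread θ
    rw [hφ]
    split_ifs with h'
    · rw [le_antisymm h h', sub_self]
      simp
    · rfl
  have hcostc : Integrable (fun θ => π0 * qc θ - u (qc θ) θ - π2 * (f - qc θ)) μ :=
    ((hqc.const_mul π0).sub huc).sub (((integrable_const f).sub hqc).const_mul π2)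
  have hcosta : Integrable (fun θ => π0 * qa θ - u (qa θ) θ) μ :=
    (hqa.const_mul π0).sub hua
  have hdev : Integrable (fun θ => π2 * (f - qa θ)) μ :=
    ((integrable_const f).sub hqa).const_mul π2
  have hdev0 : ∫ θ, π2 * (f - qa θ) ∂μ = 0 := by
    rw [integral_const_mul, integral_sub (integrable_const f) hqa, ← hf]
    simp
  have hcalled : ∫ θ, (π0 * qc θ - u (qc θ) θ - π2 * (f - qc θ)) ∂μ ≤
      ∫ θ, (π0 * qa θ - u (qa θ) θ) ∂μ := by
    calc ∫ θ, (π0 * qc θ - u (qc θ) θ - π2 * (f - qc θ)) ∂μ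
        ≤ ∫ θ, (π0 * qa θ - u (qa θ) θ - π2 * (f - qa θ)) ∂μ :=
          integral_mono hcostc (hcosta.sub hdev) fun θ => by
            have := hminc θ (qa θ)
            dsimp only
            linarith
      _ = ∫ θ, (π0 * qa θ - u (qa θ) θ) ∂μ := by
          rw [integral_sub hcosta hdev, hdev0, sub_zero]
  simp only [hpen, add_zero]
  linarith [mul_le_mul_of_nonneg_left hcalled hp0]
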